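/- arXiv:1610.07078 — 2 statements merged into one kernel-verified Lean document; each statement's English description precedes it below -/
import Mathlib

section
/- Let ε > 0 and let φ, ψ : ℝ → ℂ be Schwartz functions. Define G(ξx, ξy) = ∫_ℝ e^{-i ξx t} · conj(φ(t + ε ξy / 2)) · ψ(t - ε ξy / 2) dt, which is the inner product ⟨φ, W_{-ξx,-ξy} ψ⟩. Then the double integral below converges absolutely and for every (x, y) ∈ ℝ²: (2π)^{-1} ∫_{ℝ²} e^{i(ξx x + ξy y)} G(ξx, ξy) dξx dξy = (2/ε) ∫_ℝ e^{2 i ε^{-1} y t} · conj(φ(t + x)) · ψ(x - t) dt. (This expresses the inverse Weyl transform of the rank-one operator ψ ⊗ φ* as W⁻¹(ψ⊗φ*)(x,y) = 2ε^{-1} ⟨φ, W_{2ε^{-1}y, -2ε^{-1}x} ψ̂⟩ with ψ̂(x) = ψ(-x).) -/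
open MeasureTheory

open scoped FourierTransform SchwartzMap

namespace SchwartzMap

/-- The Schwartz function `t ↦ f (t + c) * g (t - c)`. -/
noncomputable def shiftMul (f g : 𝓢(ℝ, ℂ)) (c : ℝ) : 𝓢(ℝ, ℂ) :=
  pairing (ContinuousLinearMap.mul ℂ ℂ) (compSubConstCLM ℂ (-c) f) (compSubConstCLM ℂ c g)

@[simp]
theorem shiftMul_apply (f g : 𝓢(ℝ, ℂ)) (c t : ℝ) :
    shiftMul f g c t = f (t + c) * g (t - c) := by
  simp [shiftMul]

theorem derivCLM_shiftMul (f g : 𝓢(ℝ, ℂ)) (c : ℝ) :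
    derivCLM ℂ ℂ (shiftMul f g c) =
      shiftMul (derivCLM ℂ ℂ f) g c + shiftMul f (derivCLM ℂ ℂ g) c := by
  ext t
  have h₁ := (f.hasDerivAt (t + c)).comp_add_const t c
  have h₂ := (g.hasDerivAt (t - c)).comp_sub_const t c
  have h : HasDerivAt (shiftMul f g c) _ t :=
    (h₁.mul h₂).congr_of_eventuallyEq (.of_forall fun s => shiftMul_apply f g c s)
  simp [h.deriv]

theorem integrable_integral_norm_shiftMul (f g : 𝓢(ℝ, ℂ)) :
    Integrable (fun c : ℝ => ∫ t : ℝ, ‖shiftMul f g c t‖) := by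
  have h := Integrable.integrable_convolution (ContinuousLinearMap.mul ℝ ℝ)
    f.integrable.norm g.integrable.norm.comp_neg (μ := volume)
  refine (h.comp_mul_left' (two_ne_zero' ℝ)).congr (.of_forall fun c => ?_)
  simp only [MeasureTheory.convolution, ContinuousLinearMap.mul_apply', shiftMul_apply, norm_mul]
  rw [← integral_sub_right_eq_self (fun t => ‖f (t + c)‖ * ‖g (t - c)‖) c]
  congr! 5 <;> ring

theorem norm_fourier_le_integral_norm (f : 𝓢(ℝ, ℂ)) (s : ℝ) : ‖𝓕 f s‖ ≤ ∫ t, ‖f t‖ :=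
  VectorFourier.norm_fourierIntegral_le_integral_norm _ _ _ _ _

theorem fourier_derivCLM (f : 𝓢(ℝ, ℂ)) (s : ℝ) :
    𝓕 (derivCLM ℂ ℂ f) s = (2 * Real.pi * Complex.I * s) * 𝓕 f s := by
  have h := congrFun (Real.fourier_deriv f.integrable f.differentiable
    (derivCLM ℂ ℂ f).integrable) s
  rw [smul_eq_mul] at h
  exact h

theorem one_add_sq_mul_norm_fourier_le (f : 𝓢(ℝ, ℂ)) (s : ℝ) :
    (1 + (2 * Real.pi * s) ^ 2) * ‖𝓕 f s‖ ≤
      (∫ t, ‖f t‖) + ∫ t, ‖derivCLM ℂ ℂ (derivCLM ℂ ℂ f) t‖ := by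
  have h₁ := norm_fourier_le_integral_norm f s
  have h₂ := norm_fourier_le_integral_norm (derivCLM ℂ ℂ (derivCLM ℂ ℂ f)) s
  rw [fourier_derivCLM, fourier_derivCLM, ← mul_assoc, norm_mul, ← sq, norm_pow] at h₂
  have h₃ : ‖2 * (Real.pi : ℂ) * Complex.I * s‖ ^ 2 = (2 * Real.pi * s) ^ 2 := by
    simp [mul_pow]
  rw [h₃] at h₂
  linarith

theorem exists_norm_fourier_shiftMul_le (f g : 𝓢(ℝ, ℂ)) :
    ∃ M : ℝ → ℝ, Integrable M ∧
      ∀ s c, ‖𝓕 (shiftMul f g c) s‖ ≤ (1 + (2 * Real.pi * s) ^ 2)⁻¹ * M c := by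
  have hadd (u v : 𝓢(ℝ, ℂ)) : ∫ t, ‖(u + v) t‖ ≤ (∫ t, ‖u t‖) + ∫ t, ‖v t‖ := by
    rw [← integral_add u.integrable.norm v.integrable.norm]
    exact integral_mono (u + v).integrable.norm (u.integrable.norm.add v.integrable.norm)
      fun t => norm_add_le _ _
  let D (u : 𝓢(ℝ, ℂ)) : 𝓢(ℝ, ℂ) := derivCLM ℂ ℂ u
  let N (u v : 𝓢(ℝ, ℂ)) (c : ℝ) : ℝ := ∫ t, ‖shiftMul u v c t‖
  have hN (u v : 𝓢(ℝ, ℂ)) : Integrable (N u v) := integrable_integral_norm_shiftMul u v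
  refine ⟨fun c => N f g c + ((N (D (D f)) g c + N (D f) (D g) c) +
    (N (D f) (D g) c + N f (D (D g)) c)),
    (hN _ _).add (((hN _ _).add (hN _ _)).add ((hN _ _).add (hN _ _))), fun s c => ?_⟩
  rw [le_inv_mul_iff₀ (by positivity)]
  refine (one_add_sq_mul_norm_fourier_le _ s).trans (add_le_add le_rfl ?_)
  rw [derivCLM_shiftMul, map_add, derivCLM_shiftMul, derivCLM_shiftMul]
  exact (hadd _ _).trans (add_le_add (hadd _ _) (hadd _ _))

theorem integral_exp_mul_fourier_div_two_pi (f : 𝓢(ℝ, ℂ)) (x : ℝ) :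
    ∫ a : ℝ, Complex.exp (Complex.I * (a * x)) * 𝓕 f (a / (2 * Real.pi)) =
      2 * Real.pi * f x := by
  have h : 𝓕⁻ (𝓕 f) x = f x := by rw [FourierTransform.fourierInv_fourier_eq]
  rw [fourierInv_coe, Real.fourierInv_eq'] at h
  have h' := Measure.integral_comp_div (fun s : ℝ =>
    Complex.exp (Complex.I * (2 * Real.pi * s * x)) * 𝓕 f s) (2 * Real.pi)
  rw [← h]
  convert h' using 1
  · congr! 5 with a
    push_cast
    field_simp
  · rw [abs_of_pos Real.two_pi_pos, Complex.real_smul]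
    push_cast
    congr! 5 with s
    simp
    ring_nf

end SchwartzMap

open SchwartzMap

/-- The Schwartz function `t ↦ conj (f t)`. -/
noncomputable def SchwartzMap.conj (f : 𝓢(ℝ, ℂ)) : 𝓢(ℝ, ℂ) :=
  postcompCLM (𝕜 := ℝ) (Complex.conjCLE : ℂ →L[ℝ] ℂ) f

@[simp]
theorem SchwartzMap.conj_apply (f : 𝓢(ℝ, ℂ)) (t : ℝ) :
    f.conj t = (starRingEnd ℂ) (f t) := by
  simp [SchwartzMap.conj]

theorem integral_exp_mul_shift_eq_fourier_shiftMul (ε a b : ℝ) (φ ψ : 𝓢(ℝ, ℂ)) :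
    ∫ t : ℝ, Complex.exp (-Complex.I * (a : ℂ) * (t : ℂ)) *
      (starRingEnd ℂ) (φ (t + ε * b / 2)) * ψ (t - ε * b / 2) =
      𝓕 (shiftMul φ.conj ψ (ε * b / 2)) (a / (2 * Real.pi)) := by
  rw [fourier_coe, Real.fourier_real_eq_integral_exp_smul]
  congr! 2 with t
  rw [shiftMul_apply, conj_apply, smul_eq_mul, mul_assoc]
  congr 2
  push_cast
  field_simp

theorem integrable_exp_mul_integral_exp_mul_shift (ε : ℝ) (hε : 0 < ε) (φ ψ : 𝓢(ℝ, ℂ))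
    (x y : ℝ) :
    Integrable (fun p : ℝ × ℝ =>
        Complex.exp (Complex.I * ((p.1 : ℂ) * (x : ℂ) + (p.2 : ℂ) * (y : ℂ))) *
          ∫ t : ℝ, Complex.exp (-Complex.I * (p.1 : ℂ) * (t : ℂ)) *
            (starRingEnd ℂ) (φ (t + ε * p.2 / 2)) * ψ (t - ε * p.2 / 2)) := by
  obtain ⟨M, hM, hle⟩ := exists_norm_fourier_shiftMul_le φ.conj ψ
  have hM' : Integrable (fun b : ℝ => M (ε * b / 2)) := by
    simpa [mul_div_right_comm] using hM.comp_mul_left' (R := ε / 2) (by positivity)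
  refine (integrable_inv_one_add_sq.mul_prod hM').mono' ?_ (.of_forall fun p => ?_)
  · have hφ := φ.continuous
    have hψ := ψ.continuous
    refine .mul (by fun_prop) ?_
    refine (StronglyMeasurable.integral_prod_right' (f := fun q : (ℝ × ℝ) × ℝ =>
      Complex.exp (-Complex.I * (q.1.1 : ℂ) * (q.2 : ℂ)) *
        (starRingEnd ℂ) (φ (q.2 + ε * q.1.2 / 2)) *
          ψ (q.2 - ε * q.1.2 / 2)) ?_).aestronglyMeasurable
    exact Continuous.stronglyMeasurable (by fun_prop)
  · have h : ‖Complex.exp (Complex.I * ((p.1 : ℂ) * (x : ℂ) + (p.2 : ℂ) * (y : ℂ)))‖ = 1 := by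
      simp [Complex.norm_exp]
    rw [integral_exp_mul_shift_eq_fourier_shiftMul, norm_mul, h, one_mul]
    convert hle (p.1 / (2 * Real.pi)) (ε * p.2 / 2) using 4
    field_simp

/-- Inverse Weyl transform of a rank-one operator: with
`G(ξx, ξy) = ⟨φ, W_{-ξx,-ξy} ψ⟩ = ∫ e^{-i ξx t} conj(φ(t + ε ξy/2)) ψ(t - ε ξy/2) dt`,
the double integral `(2π)⁻¹ ∫∫ e^{i(ξx x + ξy y)} G(ξx, ξy) dξx dξy` converges absolutely
and equals `(2/ε) ∫ e^{2iε⁻¹yt} conj(φ(t + x)) ψ(x - t) dt`. -/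
theorem statement3 (ε : ℝ) (hε : 0 < ε) (φ ψ : SchwartzMap ℝ ℂ) :
    ∀ x y : ℝ,
      Integrable (fun p : ℝ × ℝ =>
        Complex.exp (Complex.I * ((p.1 : ℂ) * (x : ℂ) + (p.2 : ℂ) * (y : ℂ))) *
          ∫ t : ℝ, Complex.exp (-Complex.I * (p.1 : ℂ) * (t : ℂ)) *
            (starRingEnd ℂ) (φ (t + ε * p.2 / 2)) * ψ (t - ε * p.2 / 2)) ∧
      (2 * Real.pi : ℂ)⁻¹ *
        ∫ p : ℝ × ℝ,
          Complex.exp (Complex.I * ((p.1 : ℂ) * (x : ℂ) + (p.2 : ℂ) * (y : ℂ))) *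
            ∫ t : ℝ, Complex.exp (-Complex.I * (p.1 : ℂ) * (t : ℂ)) *
              (starRingEnd ℂ) (φ (t + ε * p.2 / 2)) * ψ (t - ε * p.2 / 2) =
      (2 / (ε : ℂ)) * ∫ t : ℝ, Complex.exp (2 * Complex.I * (ε : ℂ)⁻¹ * (y : ℂ) * (t : ℂ)) *
        (starRingEnd ℂ) (φ (t + x)) * ψ (x - t) := by
  intro x y
  have hint := integrable_exp_mul_integral_exp_mul_shift ε hε φ ψ x y
  refine ⟨hint, ?_⟩
  have hπ : (2 * Real.pi : ℂ) ≠ 0 := by simp [Real.pi_ne_zero]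
  rw [Measure.volume_eq_prod, integral_prod_symm _ hint]
  have hinner (b : ℝ) : ∫ a : ℝ,
      Complex.exp (Complex.I * ((a : ℂ) * (x : ℂ) + (b : ℂ) * (y : ℂ))) *
        ∫ t : ℝ, Complex.exp (-Complex.I * (a : ℂ) * (t : ℂ)) *
          (starRingEnd ℂ) (φ (t + ε * b / 2)) * ψ (t - ε * b / 2) =
      (2 * Real.pi : ℂ) * (Complex.exp (Complex.I * (b * y)) *
        shiftMul φ.conj ψ (ε * b / 2) x) := by
    simp_rw [integral_exp_mul_shift_eq_fourier_shiftMul, mul_add, Complex.exp_add,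
      mul_comm (Complex.exp (Complex.I * (_ * (x : ℂ)))), mul_assoc]
    rw [integral_const_mul, integral_exp_mul_fourier_div_two_pi]
    ring
  simp_rw [hinner]
  rw [integral_const_mul, inv_mul_cancel_left₀ hπ]
  have h := Measure.integral_comp_mul_left (fun t : ℝ =>
    Complex.exp (2 * Complex.I * (ε : ℂ)⁻¹ * (y : ℂ) * (t : ℂ)) *
      (starRingEnd ℂ) (φ (t + x)) * ψ (x - t)) (ε / 2)
  rw [abs_of_pos (by positivity), Complex.real_smul] at h
  convert h using 1
  · congr! 2 with b
    have hε' : (ε : ℂ) ≠ 0 := by exact_mod_cast hε.ne'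
    rw [shiftMul_apply, conj_apply, mul_assoc, add_comm x, mul_div_right_comm]
    congr 2
    push_cast
    field_simp
  · simp
end

section
/- Let j ∈ ℤ and λ > 0, and define ω_{λ,j} : ℝ² \ {(0,0)} → ℂ by ω_{λ,j}(x, y) = i^{-|j|} J_{|j|}(λ^{1/2} ρ) e^{i j θ}, where ρ = (x² + y²)^{1/2} and e^{iθ} = (x + iy)/ρ. Then ω_{λ,j} satisfies the Helmholtz eigenvalue equation -∂_x² ω_{λ,j}(x,y) - ∂_y² ω_{λ,j}(x,y) = λ · ω_{λ,j}(x,y) for all (x, y) ≠ (0, 0). (These are the cylindrical-harmonic spectral vectors of the Laplacian l = -Δ on ℝ².) -/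
/-- The Bessel function of the first kind of integer order `j`. -/
noncomputable def besselJ (j : ℕ) (x : ℝ) : ℝ :=
  (x / 2) ^ j * ∑' k : ℕ, ((-1 : ℝ) ^ k * (x / 2) ^ (2 * k)) / ((k.factorial : ℝ) * ((k + j).factorial : ℝ))

/-- The cylindrical harmonic `ω_{λ,j}(x,y) = i^{-|j|} J_{|j|}(√λ ρ) e^{ijθ}` with
`ρ = √(x²+y²)` and `e^{iθ} = (x+iy)/ρ`. -/
noncomputable def omegaFun (lam : ℝ) (j : ℤ) (x y : ℝ) : ℂ :=
  Complex.I ^ (-(j.natAbs : ℤ)) *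
    (besselJ j.natAbs (Real.sqrt lam * Real.sqrt (x ^ 2 + y ^ 2)) : ℝ) *
    (((x : ℂ) + Complex.I * (y : ℂ)) / ((Real.sqrt (x ^ 2 + y ^ 2) : ℝ) : ℂ)) ^ j

/-- The entire function `u ↦ ∑ₖ (-u)ᵏ / (k! (k+n)!)` (Bessel–Clifford function at `-u`), so that
`J_n(x) = (x/2)ⁿ besselClifford n (x²/4)`. -/
noncomputable def besselClifford (n : ℕ) (u : ℝ) : ℝ :=
  ∑' k : ℕ, ((-1 : ℝ) ^ k * u ^ k) / ((k.factorial : ℝ) * ((k + n).factorial : ℝ))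

theorem one_le_cast_factorial (m : ℕ) : (1 : ℝ) ≤ (m.factorial : ℝ) := by
  exact_mod_cast m.factorial_pos

theorem summable_besselClifford (n : ℕ) (u : ℝ) :
    Summable fun k : ℕ =>
      ((-1 : ℝ) ^ k * u ^ k) / ((k.factorial : ℝ) * ((k + n).factorial : ℝ)) := by
  refine Summable.of_norm_bounded (Real.summable_pow_div_factorial |u|) fun k => ?_
  rw [norm_div, norm_mul, norm_pow, norm_pow, norm_neg, norm_one, one_pow, one_mul,
    Real.norm_eq_abs, Real.norm_of_nonneg (by positivity)]
  gcongr
  exact le_mul_of_one_le_right (by positivity) (one_le_cast_factorial _)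

theorem besselClifford_recurrence (n : ℕ) (u : ℝ) :
    u * besselClifford (n + 2) u - (n + 1) * besselClifford (n + 1) u + besselClifford n u = 0 := by
  have h0 := (summable_besselClifford n u).hasSum
  have h1 := (summable_besselClifford (n + 1) u).hasSum.mul_left ((n : ℝ) + 1)
  have h2 := (summable_besselClifford (n + 2) u).hasSum.mul_left u
  have h := (hasSum_nat_add_iff' 1).mpr (h1.sub h0)
  have heq : (fun k : ℕ => u * (((-1 : ℝ) ^ k * u ^ k) /
      ((k.factorial : ℝ) * ((k + (n + 2)).factorial : ℝ)))) = fun k : ℕ =>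
      ((n : ℝ) + 1) * (((-1 : ℝ) ^ (k + 1) * u ^ (k + 1)) /
        (((k + 1).factorial : ℝ) * ((k + 1 + (n + 1)).factorial : ℝ))) -
      ((-1 : ℝ) ^ (k + 1) * u ^ (k + 1)) /
        (((k + 1).factorial : ℝ) * ((k + 1 + n).factorial : ℝ)) := by
    funext k
    rw [show k + (n + 2) = (k + n + 1) + 1 by ring, show k + 1 + (n + 1) = (k + n + 1) + 1 by ring,
      show k + 1 + n = k + n + 1 by ring, Nat.factorial_succ (k + n + 1), Nat.factorial_succ k]
    push_cast
    field_simp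
    ring
  rw [heq] at h2
  have key := h2.unique h
  have hn : ((n + 1).factorial : ℝ) = (n + 1) * n.factorial := by
    rw [Nat.factorial_succ]; push_cast; ring
  simp only [Finset.sum_range_one, pow_zero, Nat.factorial_zero, Nat.cast_one, zero_add, one_mul,
    hn, mul_one_div] at key
  rw [div_mul_cancel_left₀ (by positivity), one_div, sub_self, sub_zero] at key
  unfold besselClifford
  linear_combination key

theorem hasDerivAt_besselClifford (n : ℕ) (u : ℝ) :
    HasDerivAt (besselClifford n) (-besselClifford (n + 1) u) u := by
  have hs : Summable fun k : ℕ => (k : ℝ) * (|u| + 1) ^ (k - 1) / k.factorial := by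
    rw [← summable_nat_add_iff 1]
    refine (Real.summable_pow_div_factorial (|u| + 1)).congr fun k => ?_
    rw [Nat.factorial_succ]
    push_cast
    field_simp
  have hb (v : ℝ) (hv : v ∈ Metric.ball (0 : ℝ) (|u| + 1)) (k : ℕ) :
      ‖((-1 : ℝ) ^ k * (k * v ^ (k - 1))) / ((k.factorial : ℝ) * ((k + n).factorial : ℝ))‖ ≤
        (k : ℝ) * (|u| + 1) ^ (k - 1) / k.factorial := by
    have hv' : |v| ≤ |u| + 1 := by simpa using (mem_ball_zero_iff.mp hv).le
    rw [norm_div, norm_mul, norm_mul, norm_pow, norm_pow, norm_neg, norm_one, one_pow, one_mul,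
      Real.norm_eq_abs v, Real.norm_of_nonneg (by positivity), Real.norm_of_nonneg (by positivity)]
    gcongr
    exact le_mul_of_one_le_right (by positivity) (one_le_cast_factorial _)
  have hu : u ∈ Metric.ball (0 : ℝ) (|u| + 1) := by simp
  refine (hasDerivAt_tsum_of_isPreconnected hs Metric.isOpen_ball (convex_ball _ _).isPreconnected
    (fun k v _ => ((hasDerivAt_pow k v).const_mul _).div_const _)
    (fun k v hv => hb v hv k) hu (summable_besselClifford n u) hu).congr_deriv ?_
  rw [besselClifford, ← tsum_neg]
  refine (Summable.of_norm_bounded hs (hb u hu)).tsum_eq_zero_add.trans ?_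
  simp only [Nat.cast_zero, zero_mul, mul_zero, zero_div, zero_add]
  refine tsum_congr fun k => ?_
  rw [show k + 1 + n = k + (n + 1) by ring, Nat.factorial_succ k, Nat.add_sub_cancel]
  push_cast
  field_simp
  ring

/-- A line restriction of `(x, y) ↦ wⁿ besselClifford m (c (x² + y²))` with `w` affine. -/
noncomputable def cliffordSlice (a b : ℂ) (c d : ℝ) (n m : ℕ) (t : ℝ) : ℂ :=
  (a * t + b) ^ n * (besselClifford m (c * (t ^ 2 + d)) : ℝ)

theorem hasDerivAt_cliffordSlice (a b : ℂ) (c d : ℝ) (n m : ℕ) (t : ℝ) :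
    HasDerivAt (cliffordSlice a b c d n m)
      (n * a * cliffordSlice a b c d (n - 1) m t - 2 * c * t * cliffordSlice a b c d n (m + 1) t)
      t := by
  have h1 : HasDerivAt (fun t : ℝ => a * (t : ℂ) + b) a t := by
    simpa using ((hasDerivAt_id t).ofReal_comp.const_mul a).add_const b
  have h2 : HasDerivAt (fun t : ℝ => c * (t ^ 2 + d)) (c * (2 * t)) t := by
    simpa using ((hasDerivAt_pow 2 t).add_const d).const_mul c
  have h3 := ((hasDerivAt_besselClifford m (c * (t ^ 2 + d))).comp t h2).ofReal_comp
  refine ((h1.pow n).mul h3).congr_deriv ?_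
  simp only [cliffordSlice, Function.comp, Pi.pow_apply]
  push_cast
  ring

theorem deriv_deriv_cliffordSlice (a b : ℂ) (c d : ℝ) (n m : ℕ) (t : ℝ) :
    deriv (deriv (cliffordSlice a b c d n m)) t =
      n * a * ((n - 1 : ℕ) * a * cliffordSlice a b c d (n - 1 - 1) m t
        - 2 * c * t * cliffordSlice a b c d (n - 1) (m + 1) t)
      - (2 * c * cliffordSlice a b c d n (m + 1) t
        + 2 * c * t * (n * a * cliffordSlice a b c d (n - 1) (m + 1) t
          - 2 * c * t * cliffordSlice a b c d n (m + 2) t)) := by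
  rw [funext fun t => (hasDerivAt_cliffordSlice a b c d n m t).deriv]
  have hl : HasDerivAt (fun t : ℝ => 2 * (c : ℂ) * (t : ℂ)) (2 * c) t := by
    simpa using (hasDerivAt_id t).ofReal_comp.const_mul (2 * (c : ℂ))
  exact (((hasDerivAt_cliffordSlice a b c d (n - 1) m t).const_mul (n * a)).sub
    (hl.mul (hasDerivAt_cliffordSlice a b c d n (m + 1) t))).deriv

theorem laplacian_cliffordSlice (σ : ℂ) (hσ : σ ^ 2 = -1) (c : ℝ) (n : ℕ) (x y : ℝ) :
    deriv (deriv (cliffordSlice 1 (σ * y) c (y ^ 2) n n)) x +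
      deriv (deriv (cliffordSlice σ x c (x ^ 2) n n)) y =
    -(4 * c) * cliffordSlice 1 (σ * y) c (y ^ 2) n n x := by
  have hrec := congrArg (Complex.ofReal) (besselClifford_recurrence n (c * (x ^ 2 + y ^ 2)))
  push_cast at hrec
  have hw : (n : ℂ) * ((x : ℂ) + σ * y) ^ (n - 1) * (x + σ * y) = n * (x + σ * y) ^ n := by
    cases n with
    | zero => simp
    | succ k => simp only [Nat.add_sub_cancel]; ring
  simp only [deriv_deriv_cliffordSlice, cliffordSlice, one_mul, add_comm (y ^ 2) (x ^ 2),
    add_comm (σ * (y : ℂ)) (x : ℂ)]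
  generalize (besselClifford n (c * (x ^ 2 + y ^ 2)) : ℂ) = f0 at *
  generalize (besselClifford (n + 1) (c * (x ^ 2 + y ^ 2)) : ℂ) = f1 at *
  generalize (besselClifford (n + 2) (c * (x ^ 2 + y ^ 2)) : ℂ) = f2 at *
  linear_combination (4 * c * ((x : ℂ) + σ * y) ^ n) * hrec - 4 * c * f1 * hw +
    n * (n - 1 : ℕ) * ((x : ℂ) + σ * y) ^ (n - 1 - 1) * f0 * hσ

theorem besselJ_eq (n : ℕ) (x : ℝ) :
    besselJ n x = (x / 2) ^ n * besselClifford n ((x / 2) ^ 2) := by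
  simp only [besselJ, besselClifford, pow_mul]

/-- `±i`, according to the sign of `j`. -/
noncomputable def signedI (j : ℤ) : ℂ := if 0 ≤ j then Complex.I else -Complex.I

theorem signedI_sq (j : ℤ) : signedI j ^ 2 = -1 := by
  unfold signedI; split_ifs <;> simp

theorem phase_zpow (j : ℤ) (x y : ℝ) :
    (((x : ℂ) + Complex.I * y) / (Real.sqrt (x ^ 2 + y ^ 2) : ℝ)) ^ j =
      ((x + signedI j * y) / (Real.sqrt (x ^ 2 + y ^ 2) : ℝ)) ^ j.natAbs := by
  have hr : ((Real.sqrt (x ^ 2 + y ^ 2) : ℝ) : ℂ) ^ 2 = x ^ 2 + y ^ 2 := by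
    rw [← Complex.ofReal_pow, Real.sq_sqrt (by positivity)]; push_cast; rfl
  unfold signedI
  split_ifs with hj
  · lift j to ℕ using hj
    simp
  · obtain ⟨n, rfl⟩ : ∃ n : ℕ, j = -(n : ℤ) := ⟨j.natAbs, by omega⟩
    rw [zpow_neg, zpow_natCast, Int.natAbs_neg, Int.natAbs_natCast, ← inv_pow]
    congr 1
    by_cases h : ((Real.sqrt (x ^ 2 + y ^ 2) : ℝ) : ℂ) = 0
    · simp [h]
    · refine inv_eq_of_mul_eq_one_right ?_
      rw [div_mul_div_comm, div_eq_one_iff_eq (mul_ne_zero h h), ← sq, hr]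
      linear_combination -(y : ℂ) ^ 2 * Complex.I_sq

theorem omegaFun_eq_cliffordSlice {lam : ℝ} (hlam : 0 ≤ lam) (j : ℤ) (x y : ℝ) :
    omegaFun lam j x y = Complex.I ^ (-(j.natAbs : ℤ)) * ((Real.sqrt lam / 2 : ℝ) : ℂ) ^ j.natAbs *
      cliffordSlice 1 (signedI j * y) (lam / 4) (y ^ 2) j.natAbs j.natAbs x := by
  have hu : (Real.sqrt lam * Real.sqrt (x ^ 2 + y ^ 2) / 2) ^ 2 = lam / 4 * (x ^ 2 + y ^ 2) := by
    rw [div_pow, mul_pow, Real.sq_sqrt hlam, Real.sq_sqrt (by positivity)]; ring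
  rw [omegaFun, phase_zpow, besselJ_eq, hu, cliffordSlice]
  have hw : ((Real.sqrt lam * Real.sqrt (x ^ 2 + y ^ 2) / 2 : ℝ) : ℂ) *
      ((x + signedI j * y) / (Real.sqrt (x ^ 2 + y ^ 2) : ℝ)) =
      ((Real.sqrt lam / 2 : ℝ) : ℂ) * (1 * x + signedI j * y) := by
    by_cases h : Real.sqrt (x ^ 2 + y ^ 2) = 0
    · have h' : x ^ 2 + y ^ 2 = 0 := (Real.sqrt_eq_zero (by positivity)).mp h
      have hx : x = 0 := by nlinarith
      have hy : y = 0 := by nlinarith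
      simp [hx, hy]
    · have : ((Real.sqrt (x ^ 2 + y ^ 2) : ℝ) : ℂ) ≠ 0 := by exact_mod_cast h
      push_cast
      field_simp
  have hwn := congrArg (· ^ j.natAbs) hw
  simp only [mul_pow] at hwn
  generalize Complex.I ^ (-(j.natAbs : ℤ)) = z
  push_cast at hwn ⊢
  linear_combination (z * (besselClifford j.natAbs (lam / 4 * (x ^ 2 + y ^ 2)) : ℂ)) * hwn

/-- The cylindrical harmonics solve the Helmholtz eigenvalue equation `-Δ ω_{λ,j} = λ ω_{λ,j}`. -/
theorem statement12 (j : ℤ) (lam : ℝ) (hlam : 0 < lam) (x y : ℝ) (hxy : (x, y) ≠ (0, 0)) :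
    -deriv (deriv (fun t : ℝ => omegaFun lam j t y)) x -
      deriv (deriv (fun t : ℝ => omegaFun lam j x t)) y =
    (lam : ℂ) * omegaFun lam j x y := by
  have hswap (t : ℝ) : cliffordSlice 1 (signedI j * t) (lam / 4) (t ^ 2) j.natAbs j.natAbs x =
      cliffordSlice (signedI j) x (lam / 4) (x ^ 2) j.natAbs j.natAbs t := by
    simp only [cliffordSlice, one_mul, add_comm]
  have h := laplacian_cliffordSlice (signedI j) (signedI_sq j) (lam / 4) j.natAbs x y
  simp only [omegaFun_eq_cliffordSlice hlam.le, hswap, deriv_const_mul_field'] at h ⊢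
  push_cast at h
  linear_combination (-(Complex.I ^ (-(j.natAbs : ℤ)) *
    ((Real.sqrt lam / 2 : ℝ) : ℂ) ^ j.natAbs)) * h
end
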